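/- Let m, r ∈ ℕ with m, r ≥ 1, let 0 ≤ β ≤ 1, let x_1, …, x_{m+r} be real numbers and x = x_1 + ⋯ + x_{m+r}. Then for every n ≥ 0, Σ_{j_1+⋯+j_{m+r}=n} (n!/(j_1!⋯j_{m+r}!)) B_{j_1}(x_1)⋯B_{j_m}(x_m) E_{j_{m+1}}(β;x_{m+1})⋯E_{j_{m+r}}(β;x_{m+r}) = Σ_{k=0}^n v_k Δ^k I_n(x), where v_k = m! Σ_{j=0}^k C(−r,j) β^j s(m+k−j,m)/(m+k−j)!. -/

import Mathlib

open Finset MeasureTheory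

/-- The `k`-th forward difference of `f : ℝ → ℝ`:
`Δ^k f(x) = ∑_{j=0}^k C(k,j) (-1)^(k-j) f(x+j)`. -/
noncomputable def fdiff (k : ℕ) (f : ℝ → ℝ) (x : ℝ) : ℝ :=
  ∑ j ∈ Finset.range (k + 1), (k.choose j : ℝ) * (-1 : ℝ) ^ (k - j) * f (x + j)

/-- The `k`-th forward difference of a real polynomial, as a polynomial;
its evaluation at `x` is `∑_{j=0}^k C(k,j) (-1)^(k-j) p(x+j)`. -/
noncomputable def fdiffP (k : ℕ) (p : Polynomial ℝ) : Polynomial ℝ :=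
  ∑ j ∈ Finset.range (k + 1),
    ((k.choose j : ℝ) * (-1 : ℝ) ^ (k - j)) • p.comp (Polynomial.X + Polynomial.C (j : ℝ))

/-- An Appell sequence of real polynomials: `A 0` is a nonzero constant and
`A n' = n • A (n-1)` for `n ≥ 1`. -/
def IsAppell (A : ℕ → Polynomial ℝ) : Prop :=
  (A 0).eval 0 ≠ 0 ∧ (∃ c : ℝ, A 0 = Polynomial.C c) ∧
    ∀ n : ℕ, (A (n + 1)).derivative = ((n : ℝ) + 1) • A n

/-- The forward difference transformation `L_u A`, with
`(L_u A)_n(x) = ∑_{k=0}^n (u_k/k!) Δ^k A_n(x)`. -/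
noncomputable def LP (u : ℕ → ℝ) (A : ℕ → Polynomial ℝ) (n : ℕ) : Polynomial ℝ :=
  ∑ k ∈ Finset.range (n + 1), (u k / (k.factorial : ℝ)) • fdiffP k (A n)

/-- Binomial convolution of real sequences. -/
noncomputable def bconv (u v : ℕ → ℝ) (n : ℕ) : ℝ :=
  ∑ k ∈ Finset.range (n + 1), (n.choose k : ℝ) * u k * v (n - k)

/-- Binomial convolution of Appell sequences:
`(A×C)_n(x) = ∑_{k=0}^n C(n,k) A_k(0) C_{n-k}(x)`. -/
noncomputable def aconv (A C : ℕ → Polynomial ℝ) (n : ℕ) : Polynomial ℝ :=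
  ∑ k ∈ Finset.range (n + 1), ((n.choose k : ℝ) * (A k).eval 0) • C (n - k)

/-- Stirling numbers of the second kind (real-valued):
`S(n,k) = (1/k!) ∑_{j=0}^k (-1)^(k-j) C(k,j) j^n`. -/
noncomputable def stirling2 (n k : ℕ) : ℝ :=
  (1 / (k.factorial : ℝ)) *
    ∑ j ∈ Finset.range (k + 1), (-1 : ℝ) ^ (k - j) * (k.choose j : ℝ) * (j : ℝ) ^ n

/-- Signed Stirling numbers of the first kind: the coefficient of `x^k` in
`x(x-1)⋯(x-n+1)`. -/
noncomputable def stirling1 (n k : ℕ) : ℝ :=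
  (∏ i ∈ Finset.range n, (Polynomial.X - Polynomial.C (i : ℝ))).coeff k

/-- Generalized binomial coefficient `C(y,k) = y(y-1)⋯(y-k+1)/k!`. -/
noncomputable def rchoose (y : ℝ) (k : ℕ) : ℝ :=
  (∏ i ∈ Finset.range k, (y - i)) / (k.factorial : ℝ)

/-- Apostol-Euler polynomials `E_n(β;x) = ∑_{k=0}^n (-β)^k Δ^k I_n(x)`. -/
noncomputable def apostolEuler (β : ℝ) (n : ℕ) (x : ℝ) : ℝ :=
  ∑ k ∈ Finset.range (n + 1), (-β) ^ k * fdiff k (fun y => y ^ n) x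

/-- Harmonic numbers `H_j = ∑_{i=1}^j 1/i`. -/
noncomputable def harm (j : ℕ) : ℝ := ∑ i ∈ Finset.range j, (1 : ℝ) / (i + 1)

open PowerSeries in
/-- The coefficient of a product of power series indexed by `Fin k`, as a sum over tuples. -/
theorem PowerSeries.coeff_prod_univ_fin {R : Type*} [CommSemiring R] {k : ℕ}
    (f : Fin k → PowerSeries R) (n : ℕ) :
    coeff n (∏ i, f i) = ∑ j ∈ Finset.Nat.antidiagonalTuple k n, ∏ i, coeff (j i) (f i) := by
  rw [coeff_prod]
  refine Finset.sum_bij (fun l _ => ⇑l) ?_ ?_ ?_ ?_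
  · intro l hl
    simpa [Finset.Nat.mem_antidiagonalTuple] using hl
  · intro a _ b _ h
    exact DFunLike.coe_injective h
  · intro j hj
    refine ⟨Finsupp.equivFunOnFinite.symm j, ?_, by simp⟩
    simpa [Finset.Nat.mem_antidiagonalTuple] using hj
  · simp

open PowerSeries in
/-- Finite products of the series `e^{xz}` add up the exponents. -/
theorem PowerSeries.prod_rescale_exp {ι : Type*} (s : Finset ι) (f : ι → ℝ) :
    ∏ i ∈ s, rescale (f i) (exp ℝ) = rescale (∑ i ∈ s, f i) (exp ℝ) := by
  classical
  induction s using Finset.induction_on with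
  | empty => simp
  | insert a s ha ih =>
    rw [Finset.prod_insert ha, Finset.sum_insert ha, ih, exp_mul_exp_eq_exp_add]

open PowerSeries in
/-- `(e^z - 1)^k e^{xz}` is the exponential generating function of `Δ^k I_n(x)`. -/
theorem coeff_exp_sub_one_pow_mul_rescale_exp (k n : ℕ) (x : ℝ) :
    coeff n ((exp ℝ - 1) ^ k * rescale x (exp ℝ)) =
      fdiff k (fun y => y ^ n) x / (n.factorial : ℝ) := by
  have h : (exp ℝ - 1) ^ k * rescale x (exp ℝ) = ∑ j ∈ Finset.range (k + 1),
      ((k.choose j : ℝ) * (-1 : ℝ) ^ (k - j)) • rescale (x + j) (exp ℝ) := by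
    rw [sub_eq_add_neg, add_pow, Finset.sum_mul]
    refine Finset.sum_congr rfl fun j _ => ?_
    rw [add_comm x, ← exp_mul_exp_eq_exp_add, ← exp_pow_eq_rescale_exp, smul_eq_C_mul]
    simp only [map_mul, map_pow, map_neg, map_one, map_natCast]
    ring
  rw [h, fdiff, map_sum, Finset.sum_div]
  refine Finset.sum_congr rfl fun j _ => ?_
  rw [map_smul, coeff_rescale, coeff_exp]
  simp
  ring

open PowerSeries in
/-- Substituting `e^z - 1` in `f` and multiplying by `e^{xz}` gives the exponential generating
function of the forward difference transformation with coefficients those of `f`. -/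
theorem coeff_subst_exp_sub_one_mul_rescale_exp (f : PowerSeries ℝ) (n : ℕ) (x : ℝ) :
    coeff n (f.subst (exp ℝ - 1) * rescale x (exp ℝ)) =
      (∑ k ∈ Finset.range (n + 1), coeff k f * fdiff k (fun y => y ^ n) x) /
        (n.factorial : ℝ) := by
  have hu : HasSubst (exp ℝ - 1) := HasSubst.exp_sub_one
  obtain ⟨g, hg⟩ : X ^ (n + 1) ∣ f - (trunc (n + 1) f : PowerSeries ℝ) := by
    rw [X_pow_dvd_iff]
    intro k hk
    simp [coeff_trunc, hk]
  have hX : (X : PowerSeries ℝ) ∣ exp ℝ - 1 := by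
    rw [X_dvd_iff]
    simp
  have hf : f.subst (exp ℝ - 1) = ∑ k ∈ Finset.range (n + 1),
      coeff k f • (exp ℝ - 1) ^ k + (exp ℝ - 1) ^ (n + 1) * g.subst (exp ℝ - 1) := by
    conv_lhs => rw [sub_eq_iff_eq_add'.mp hg]
    rw [subst_add hu, subst_mul hu, subst_pow hu, subst_X hu, subst_coe hu,
      Polynomial.aeval_eq_sum_range' (natDegree_trunc_lt f n)]
    congr 1
    refine Finset.sum_congr rfl fun k hk => ?_
    rw [coeff_trunc, if_pos (Finset.mem_range.mp hk)]
  have hrem : coeff n ((exp ℝ - 1) ^ (n + 1) * g.subst (exp ℝ - 1) * rescale x (exp ℝ)) = 0 :=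
    X_pow_dvd_iff.mp (((pow_dvd_pow_of_dvd hX (n + 1)).mul_right _).mul_right _) n n.lt_succ_self
  rw [hf, add_mul, map_add, hrem, add_zero, Finset.sum_mul, map_sum, Finset.sum_div]
  refine Finset.sum_congr rfl fun k _ => ?_
  rw [smul_mul_assoc, map_smul, coeff_exp_sub_one_pow_mul_rescale_exp, smul_eq_mul, mul_div_assoc]

open PowerSeries in
/-- The exponential generating function of the Apostol-Euler polynomials. -/
theorem apostolEuler_generating_function (β x : ℝ) :
    (PowerSeries.mk fun n => apostolEuler β n x / (n.factorial : ℝ)) * (1 + C β * (exp ℝ - 1)) =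
      rescale x (exp ℝ) := by
  have hu : HasSubst (exp ℝ - 1) := HasSubst.exp_sub_one
  have hmk : (PowerSeries.mk fun n => apostolEuler β n x / (n.factorial : ℝ)) =
      (PowerSeries.mk fun k => (-β) ^ k).subst (exp ℝ - 1) * rescale x (exp ℝ) := by
    ext n
    rw [coeff_subst_exp_sub_one_mul_rescale_exp]
    simp [apostolEuler]
  have hgeom : (PowerSeries.mk fun k => (-β) ^ k) * (1 + C β * X) = 1 := by
    ext n
    cases n with
    | zero => simp
    | succ n =>
      rw [mul_add, mul_one, map_add, mul_left_comm, coeff_C_mul, coeff_succ_mul_X]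
      simp [coeff_one]
      ring
  have hs : (PowerSeries.mk fun k => (-β) ^ k).subst (exp ℝ - 1) * (1 + C β * (exp ℝ - 1)) = 1 := by
    have h := congrArg (substAlgHom (S := ℝ) hu) hgeom
    simp only [C_eq_algebraMap, map_mul, map_add, map_one, AlgHom.commutes] at h ⊢
    simpa only [coe_substAlgHom, subst_X hu] using h
  rw [hmk, mul_right_comm, hs, one_mul]

/-- The Pascal-type recurrence of the signed Stirling numbers of the first kind. -/
theorem stirling1_succ_succ (n k : ℕ) :
    stirling1 (n + 1) (k + 1) = stirling1 n k - n * stirling1 n (k + 1) := by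
  rw [stirling1, Finset.prod_range_succ, mul_sub, Polynomial.coeff_sub, Polynomial.coeff_mul_X,
    Polynomial.coeff_mul_C, stirling1, stirling1, mul_comm]

theorem stirling1_zero_right (n : ℕ) : stirling1 n 0 = if n = 0 then 1 else 0 := by
  cases n with
  | zero => simp [stirling1]
  | succ n => simp [stirling1, Polynomial.coeff_zero_prod, Finset.prod_range_succ']

theorem stirling1_eq_zero_of_lt {n k : ℕ} (h : n < k) : stirling1 n k = 0 := by
  refine Polynomial.coeff_eq_zero_of_natDegree_lt (lt_of_le_of_lt ?_ h)
  refine (Polynomial.natDegree_prod_le _ _).trans ?_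
  simp only [Polynomial.natDegree_X_sub_C, Finset.sum_const, Finset.card_range, smul_eq_mul,
    mul_one, le_refl]

open PowerSeries in
/-- Substituting `e^z - 1` in the exponential generating function of `s(n,m)` gives `z^m / m!`. -/
theorem subst_exp_sub_one_stirling1 (m : ℕ) :
    (PowerSeries.mk fun n => stirling1 n m / (n.factorial : ℝ)).subst (exp ℝ - 1) =
      C ((m.factorial : ℝ)⁻¹) * X ^ m := by
  have hu : HasSubst (exp ℝ - 1) := HasSubst.exp_sub_one
  induction m with
  | zero =>
    have h : (PowerSeries.mk fun n => stirling1 n 0 / (n.factorial : ℝ)) = 1 := by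
      ext n
      rw [coeff_mk, stirling1_zero_right, coeff_one]
      split_ifs with hn <;> simp [hn]
    rw [h, ← coe_substAlgHom hu, map_one]
    simp
  | succ m ih =>
    have hD : d⁄dX ℝ (PowerSeries.mk fun n => stirling1 n (m + 1) / (n.factorial : ℝ)) * (1 + X) =
        PowerSeries.mk fun n => stirling1 n m / (n.factorial : ℝ) := by
      ext n
      rw [mul_add, mul_one, map_add]
      cases n with
      | zero => simp [coeff_derivative, stirling1_succ_succ 0]
      | succ n =>
        rw [coeff_succ_mul_X]
        simp only [coeff_derivative, coeff_mk]
        rw [stirling1_succ_succ (n + 1), Nat.factorial_succ (n + 1), Nat.factorial_succ n]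
        push_cast
        field_simp
        ring
    apply derivative.ext
    · rw [derivative_subst hu, map_sub, derivative_exp, derivative_one, sub_zero]
      have h := congrArg (substAlgHom (S := ℝ) hu) hD
      rw [map_mul, map_add, map_one, coe_substAlgHom, subst_X hu, add_sub_cancel, ih] at h
      rw [h, Derivation.leibniz, derivative_C, derivative_pow, derivative_X]
      have hC : C (((m + 1).factorial : ℝ)⁻¹) * ((m + 1 : ℕ) : PowerSeries ℝ) =
          C ((m.factorial : ℝ)⁻¹) := by
        rw [← map_natCast (C (R := ℝ)), ← map_mul, Nat.factorial_succ]
        congr 1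
        push_cast
        field_simp
      rw [← hC]
      simp
      ring
    · have h0 : constantCoeff (PowerSeries.mk fun n =>
          stirling1 n (m + 1) / (n.factorial : ℝ)) = 0 := by
        simp [stirling1_eq_zero_of_lt]
      have hu0 : constantCoeff (exp ℝ - 1) = 0 := by simp
      exact (constantCoeff_subst_eq_zero hu0 _ h0).trans (by simp)

theorem rchoose_eq_choose (y : ℝ) (k : ℕ) : rchoose y k = Ring.choose y k := by
  have h : (descPochhammer ℤ k).smeval y = ∏ i ∈ Finset.range k, (y - i) := by
    induction k with
    | zero => simp
    | succ k ih =>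
      rw [descPochhammer_succ_right, Polynomial.smeval_mul, ih, Finset.prod_range_succ]
      simp [Polynomial.smeval_sub, Polynomial.smeval_natCast]
  rw [Ring.choose_eq_smul, h, rchoose, smul_eq_mul, div_eq_inv_mul]

open PowerSeries in
/-- The binomial series `∑ C(-r,k) β^k X^k` is inverse to `(1 + βX)^r`. -/
theorem mk_rchoose_neg_mul_pow (r : ℕ) (β : ℝ) :
    (PowerSeries.mk fun k => rchoose (-(r : ℝ)) k * β ^ k) * (1 + C β * X) ^ r = 1 := by
  have h : (PowerSeries.mk fun k => rchoose (-(r : ℝ)) k * β ^ k) =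
      rescale β (binomialSeries ℝ (-(r : ℝ))) := by
    ext k
    simp [rchoose_eq_choose, mul_comm]
  have hX : 1 + C β * X = rescale β (1 + X : PowerSeries ℝ) := by
    simp [rescale_X]
  rw [h, hX, ← map_pow, ← binomialSeries_nat (R := ℝ), ← map_mul, ← binomialSeries_add]
  simp

open PowerSeries in
theorem mk_stirling1_shift_mul_X_pow (m : ℕ) :
    (PowerSeries.mk fun k => stirling1 (m + k) m / ((m + k).factorial : ℝ)) * X ^ m =
      PowerSeries.mk fun n => stirling1 n m / (n.factorial : ℝ) := by
  ext n
  rw [coeff_mul_X_pow']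
  split_ifs with h
  · simp [Nat.add_sub_cancel' h]
  · simp [stirling1_eq_zero_of_lt (not_le.mp h)]

open PowerSeries in
/-- The series with coefficients `v_k`, evaluated at `e^z - 1`, equals
`z^m / ((e^z - 1)^m (1 + β(e^z - 1))^r)`. -/
theorem subst_exp_sub_one_mixed_coefficients (m r : ℕ) (β : ℝ) :
    (PowerSeries.mk fun k => (m.factorial : ℝ) * ∑ i ∈ Finset.range (k + 1),
        rchoose (-(r : ℝ)) i * β ^ i * stirling1 (m + k - i) m /
          ((m + k - i).factorial : ℝ)).subst (exp ℝ - 1) *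
      ((exp ℝ - 1) ^ m * (1 + C β * (exp ℝ - 1)) ^ r) = X ^ m := by
  have hu : HasSubst (exp ℝ - 1) := HasSubst.exp_sub_one
  set V : PowerSeries ℝ := PowerSeries.mk fun k => (m.factorial : ℝ) * ∑ i ∈ Finset.range (k + 1),
        rchoose (-(r : ℝ)) i * β ^ i * stirling1 (m + k - i) m / ((m + k - i).factorial : ℝ)
  have hV : V = C (m.factorial : ℝ) * ((PowerSeries.mk fun k => rchoose (-(r : ℝ)) k * β ^ k) *
      PowerSeries.mk fun k => stirling1 (m + k) m / ((m + k).factorial : ℝ)) := by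
    ext k
    rw [coeff_C_mul, coeff_mul, Finset.Nat.sum_antidiagonal_eq_sum_range_succ_mk, coeff_mk]
    congr 1
    refine Finset.sum_congr rfl fun i hi => ?_
    have hi' : i ≤ k := Nat.lt_succ_iff.mp (Finset.mem_range.mp hi)
    simp only [coeff_mk, Nat.add_sub_assoc hi', mul_div_assoc]
  have hmul : V * (X ^ m * (1 + C β * X) ^ r) =
      C (m.factorial : ℝ) * PowerSeries.mk fun n => stirling1 n m / (n.factorial : ℝ) := by
    rw [hV, ← mk_stirling1_shift_mul_X_pow]
    have hinv := mk_rchoose_neg_mul_pow r β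
    generalize (1 + C β * X : PowerSeries ℝ) ^ r = w at hinv ⊢
    linear_combination (C (m.factorial : ℝ) *
      (PowerSeries.mk fun k => stirling1 (m + k) m / ((m + k).factorial : ℝ)) * X ^ m) *
        hinv
  have h := congrArg (substAlgHom (S := ℝ) hu) hmul
  simp only [map_mul, map_pow, map_add, map_one, coe_substAlgHom, subst_X hu,
    subst_exp_sub_one_stirling1, C_eq_algebraMap, AlgHom.commutes] at h
  rw [C_eq_algebraMap, h, ← mul_assoc, ← map_mul,
    mul_inv_cancel₀ (Nat.cast_ne_zero.mpr m.factorial_ne_zero), map_one, one_mul]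

/-- mixed higher-order convolution identity for Bernoulli and Apostol-Euler
polynomials, with coefficients `v_k = m! ∑_{j=0}^k C(-r,j) β^j s(m+k-j,m)/(m+k-j)!`. -/
theorem bernoulli_apostolEuler_mixed_convolution (m r : ℕ) (hm : 1 ≤ m) (hr : 1 ≤ r)
    (β : ℝ) (hβ0 : 0 ≤ β) (hβ1 : β ≤ 1) (xs : Fin (m + r) → ℝ) (x : ℝ)
    (hx : ∑ i, xs i = x) (n : ℕ) :
    ∑ j ∈ Finset.Nat.antidiagonalTuple (m + r) n,
        (n.factorial : ℝ) / (∏ i, ((j i).factorial : ℝ)) *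
          ((∏ i : Fin m,
              (Polynomial.aeval (xs (Fin.castAdd r i))) (Polynomial.bernoulli (j (Fin.castAdd r i)))) *
            ∏ i : Fin r, apostolEuler β (j (Fin.natAdd m i)) (xs (Fin.natAdd m i)))
      = ∑ k ∈ Finset.range (n + 1),
          ((m.factorial : ℝ) * ∑ i ∈ Finset.range (k + 1),
              rchoose (-(r : ℝ)) i * β ^ i * stirling1 (m + k - i) m /
                ((m + k - i).factorial : ℝ)) *
            fdiff k (fun y => y ^ n) x := by
  have hBgf : ∀ t : ℝ, (PowerSeries.mk fun k => (Polynomial.aeval t) (Polynomial.bernoulli k) /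
      (k.factorial : ℝ)) * (PowerSeries.exp ℝ - 1) =
        PowerSeries.X * PowerSeries.rescale t (PowerSeries.exp ℝ) := by
    intro t
    rw [← Polynomial.bernoulli_generating_function]
    congr 2
    ext k
    rw [map_smul, Rat.smul_def, div_eq_inv_mul]
    simp
  let F : Fin (m + r) → PowerSeries ℝ := Fin.addCases
    (fun i => PowerSeries.mk fun k =>
      (Polynomial.aeval (xs (Fin.castAdd r i))) (Polynomial.bernoulli k) / (k.factorial : ℝ))
    (fun i => PowerSeries.mk fun k =>
      apostolEuler β k (xs (Fin.natAdd m i)) / (k.factorial : ℝ))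
  set V : PowerSeries ℝ := PowerSeries.mk fun k => (m.factorial : ℝ) *
    ∑ i ∈ Finset.range (k + 1), rchoose (-(r : ℝ)) i * β ^ i * stirling1 (m + k - i) m /
      ((m + k - i).factorial : ℝ) with hV
  set u : PowerSeries ℝ := PowerSeries.exp ℝ - 1 with hu
  have hF : (∏ i, F i) * (u ^ m * (1 + PowerSeries.C β * u) ^ r) =
      PowerSeries.X ^ m * PowerSeries.rescale x (PowerSeries.exp ℝ) := by
    rw [← hx, ← PowerSeries.prod_rescale_exp, Fin.prod_univ_add, Fin.prod_univ_add,
      mul_mul_mul_comm, ← Fin.prod_const m u, ← Fin.prod_const r, ← Finset.prod_mul_distrib,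
      ← Finset.prod_mul_distrib, ← mul_assoc, ← Fin.prod_const m PowerSeries.X,
      ← Finset.prod_mul_distrib]
    congr 1
    · refine Finset.prod_congr rfl fun i _ => ?_
      simp only [F, Fin.addCases_left]
      exact hBgf _
    · refine Finset.prod_congr rfl fun i _ => ?_
      simp only [F, Fin.addCases_right]
      exact apostolEuler_generating_function β _
  have hu0 : u ≠ 0 := by
    intro h
    have := congrArg (PowerSeries.coeff 1) h
    simp [hu, PowerSeries.coeff_exp, PowerSeries.coeff_one] at this
  have hβu : 1 + PowerSeries.C β * u ≠ 0 := by
    intro h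
    have := congrArg PowerSeries.constantCoeff h
    simp [hu] at this
  have hprod : ∏ i, F i = V.subst u * PowerSeries.rescale x (PowerSeries.exp ℝ) := by
    refine mul_right_cancel₀ (mul_ne_zero (pow_ne_zero m hu0) (pow_ne_zero r hβu)) ?_
    rw [hF, mul_right_comm, subst_exp_sub_one_mixed_coefficients]
  have hcoeff := congrArg (PowerSeries.coeff n) hprod
  rw [PowerSeries.coeff_prod_univ_fin, coeff_subst_exp_sub_one_mul_rescale_exp,
    eq_div_iff (Nat.cast_ne_zero.mpr n.factorial_ne_zero), Finset.sum_mul] at hcoeff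
  simp only [hV, PowerSeries.coeff_mk] at hcoeff
  rw [← hcoeff]
  refine Finset.sum_congr rfl fun j _ => ?_
  rw [Fin.prod_univ_add, Fin.prod_univ_add]
  simp only [F, Fin.addCases_left, Fin.addCases_right, PowerSeries.coeff_mk,
    Finset.prod_div_distrib]
  ring
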